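/- arXiv:2309.13167 — 4 statements merged into one kernel-verified Lean document; each statement's English description precedes it below -/
import Mathlib

section
/- Let X and Z be finite types and T a positive natural number. Fix an observed sequence x : Fin (T+1) → X. Let π : Z → ℝ be a probability mass function (the prior on z₀), let P : Z → Z → ℝ be a row-stochastic transition kernel (the prior transitions), let Obs : Z → X → ℝ be a row-stochastic emission kernel, let r : Z → ℝ be a probability mass function (the posterior over z₀ given x 0), and let Q : Z → Z → ℝ be a row-stochastic transition kernel (the posterior transitions). Assume π, P, Obs, r, Q are strictly positive. Define the evidence L = ∑_{z : Fin (T+1) → Z} π (z 0) * Obs (z 0) (x 0) * ∏_{t=1}^{T} P (z (t−1)) (z t) * Obs (z t) (x t), and the posterior path weight q(z) = r (z 0) * ∏_{t=1}^{T} Q (z (t−1)) (z t). Then Real.log L ≥ ∑_z q(z) * ∑_{t=0}^{T} Real.log (Obs (z t) (x t)) − KL(r‖π) − ∑_{t=1}^{T} ∑_z q(z) * KL(Q (z (t−1)) ‖ P (z (t−1))). -/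
open scoped Classical

/-- Kullback–Leibler divergence between probability mass functions on a finite type,
with the sum taken over the support of the first argument. -/
noncomputable def KL {Z : Type*} [Fintype Z] (a b : Z → ℝ) : ℝ :=
  ∑ z ∈ Finset.univ.filter fun z => 0 < a z, a z * Real.log (a z / b z)

theorem sum_markov_snoc {Z : Type*} [Fintype Z] (g : Z → ℝ) (Q : Z → Z → ℝ) (n : ℕ)
    (F : (Fin (n + 1) → Z) → Z → ℝ) :
    ∑ z : Fin (n + 2) → Z,
        (g (z 0) * ∏ i : Fin (n + 1), Q (z i.castSucc) (z i.succ)) *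
          F (fun i => z i.castSucc) (z (Fin.last (n + 1)))
      = ∑ z : Fin (n + 1) → Z, (g (z 0) * ∏ i : Fin n, Q (z i.castSucc) (z i.succ)) *
          ∑ w : Z, Q (z (Fin.last n)) w * F z w := by
  rw [← (Fin.snocEquiv fun _ : Fin (n + 2) => Z).sum_comp, Fintype.sum_prod_type_right]
  refine Finset.sum_congr rfl fun z _ => ?_
  rw [Finset.mul_sum]
  refine Finset.sum_congr rfl fun w _ => ?_
  have h0 : (Fin.snoc z w : Fin (n + 2) → Z) 0 = z 0 := by
    rw [← Fin.castSucc_zero, Fin.snoc_castSucc]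
  simp only [Fin.snocEquiv_apply, Fin.prod_univ_castSucc, Fin.snoc_castSucc, Fin.succ_castSucc,
    Fin.succ_last, Fin.snoc_last, h0]
  ring

theorem sum_markov_initial {Z : Type*} [Fintype Z] (g : Z → ℝ) (Q : Z → Z → ℝ)
    (hQ : ∀ w, ∑ z : Z, Q w z = 1) (f : Z → ℝ) (n : ℕ) :
    ∑ z : Fin (n + 1) → Z, (g (z 0) * ∏ i : Fin n, Q (z i.castSucc) (z i.succ)) * f (z 0)
      = ∑ w : Z, g w * f w := by
  induction n with
  | zero =>
    rw [← (Equiv.funUnique (Fin 1) Z).symm.sum_comp]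
    simp
  | succ n ih =>
    rw [← ih]
    simpa [← Finset.sum_mul, hQ] using sum_markov_snoc g Q n fun z _ => f (z 0)

theorem sum_markov_transition {Z : Type*} [Fintype Z] (g : Z → ℝ) (Q : Z → Z → ℝ)
    (hQ : ∀ w, ∑ z : Z, Q w z = 1) (h : Z → Z → ℝ) (n : ℕ) (i : Fin n) :
    ∑ z : Fin (n + 1) → Z,
        (g (z 0) * ∏ j : Fin n, Q (z j.castSucc) (z j.succ)) * h (z i.castSucc) (z i.succ)
      = ∑ z : Fin (n + 1) → Z, (g (z 0) * ∏ j : Fin n, Q (z j.castSucc) (z j.succ)) *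
          ∑ w : Z, Q (z i.castSucc) w * h (z i.castSucc) w := by
  induction n with
  | zero => exact i.elim0
  | succ n ih =>
    cases i using Fin.lastCases with
    | last =>
      have h1 := sum_markov_snoc g Q n fun z w => h (z (Fin.last n)) w
      have h2 := sum_markov_snoc g Q n fun z _ =>
        ∑ w : Z, Q (z (Fin.last n)) w * h (z (Fin.last n)) w
      simp only [← Finset.sum_mul, hQ, one_mul] at h2
      exact h1.trans h2.symm
    | cast i =>
      have h1 := sum_markov_snoc g Q n fun z _ => h (z i.castSucc) (z i.succ)
      have h2 := sum_markov_snoc g Q n fun z _ =>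
        ∑ w : Z, Q (z i.castSucc) w * h (z i.castSucc) w
      simp only [← Finset.sum_mul, hQ, one_mul] at h1 h2
      exact h1.trans ((ih i).trans h2.symm)

theorem sum_mul_log_div_le_log_sum {ι : Type*} [Fintype ι] (p q : ι → ℝ)
    (hp : ∀ i, 0 < p i) (hq : ∀ i, 0 < q i) (hq1 : ∑ i, q i = 1) :
    ∑ i, q i * Real.log (p i / q i) ≤ Real.log (∑ i, p i) := by
  have h := strictConcaveOn_log_Ioi.concaveOn.le_map_sum (t := Finset.univ) (w := q)
    (p := fun i => p i / q i) (fun i _ => (hq i).le) hq1 fun i _ => div_pos (hp i) (hq i)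
  simpa [mul_div_cancel₀ _ (hq _).ne', smul_eq_mul] using h

theorem KL_eq_sum {Z : Type*} [Fintype Z] (a b : Z → ℝ) (ha : ∀ z, 0 < a z) :
    KL a b = ∑ z, a z * Real.log (a z / b z) := by
  simp [KL, ha]

/-- ELBO for a hidden Markov sequence model: the log-evidence of the observed
sequence is bounded below by the expected reconstruction term minus the initial KL
term minus the expected transition KL terms. -/
theorem sequence_elbo
    (X Z : Type*) [Fintype X] [Fintype Z] (T : ℕ) (hT : 0 < T)
    (x : Fin (T + 1) → X)
    (π : Z → ℝ) (hπ0 : ∀ z, 0 < π z) (hπ1 : ∑ z : Z, π z = 1)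
    (P : Z → Z → ℝ) (hP0 : ∀ w z, 0 < P w z) (hP1 : ∀ w, ∑ z : Z, P w z = 1)
    (Obs : Z → X → ℝ) (hO0 : ∀ z a, 0 < Obs z a) (hO1 : ∀ z, ∑ a : X, Obs z a = 1)
    (r : Z → ℝ) (hr0 : ∀ z, 0 < r z) (hr1 : ∑ z : Z, r z = 1)
    (Q : Z → Z → ℝ) (hQ0 : ∀ w z, 0 < Q w z) (hQ1 : ∀ w, ∑ z : Z, Q w z = 1)
    (L : ℝ)
    (hL : L = ∑ z : Fin (T + 1) → Z,
      π (z 0) * Obs (z 0) (x 0) *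
        ∏ i : Fin T, P (z i.castSucc) (z i.succ) * Obs (z i.succ) (x i.succ))
    (q : (Fin (T + 1) → Z) → ℝ)
    (hq : ∀ z, q z = r (z 0) * ∏ i : Fin T, Q (z i.castSucc) (z i.succ)) :
    Real.log L
      ≥ (∑ z : Fin (T + 1) → Z,
            q z * ∑ t : Fin (T + 1), Real.log (Obs (z t) (x t)))
        - KL r π
        - ∑ i : Fin T, ∑ z : Fin (T + 1) → Z,
            q z * KL (Q (z i.castSucc)) (P (z i.castSucc)) := by
  have hqpos : ∀ z, 0 < q z := fun z => by
    rw [hq]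
    exact mul_pos (hr0 _) (Finset.prod_pos fun _ _ => hQ0 _ _)
  have hq1 : ∑ z, q z = 1 := by
    simpa [hq, hr1] using sum_markov_initial r Q hQ1 (fun _ => 1) T
  have hKL0 : KL r π = ∑ z, q z * Real.log (r (z 0) / π (z 0)) := by
    simp only [KL_eq_sum r π hr0, hq]
    exact (sum_markov_initial r Q hQ1 (fun w => Real.log (r w / π w)) T).symm
  have hKL : ∀ i : Fin T, ∑ z, q z * KL (Q (z i.castSucc)) (P (z i.castSucc))
      = ∑ z, q z * Real.log (Q (z i.castSucc) (z i.succ) / P (z i.castSucc) (z i.succ)) := by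
    intro i
    simp only [KL_eq_sum _ _ (hQ0 _), hq]
    exact (sum_markov_transition r Q hQ1 (fun v w => Real.log (Q v w / P v w)) T i).symm
  have hJ := sum_mul_log_div_le_log_sum
    (fun z : Fin (T + 1) → Z => π (z 0) * Obs (z 0) (x 0) *
      ∏ i : Fin T, P (z i.castSucc) (z i.succ) * Obs (z i.succ) (x i.succ)) q
    (fun z => mul_pos (mul_pos (hπ0 _) (hO0 _ _))
      (Finset.prod_pos fun _ _ => mul_pos (hP0 _ _) (hO0 _ _))) hqpos hq1
  rw [hL, ge_iff_le]
  refine le_trans (le_of_eq ?_) hJ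
  rw [hKL0, Finset.sum_congr rfl fun i _ => hKL i, Finset.sum_comm, ← Finset.sum_sub_distrib,
    ← Finset.sum_sub_distrib]
  refine Finset.sum_congr rfl fun z _ => ?_
  rw [← Finset.mul_sum, ← mul_sub, ← mul_sub]
  congr 1
  have hPne : ∀ w z, P w z ≠ 0 := fun w z => (hP0 w z).ne'
  have hQne : ∀ w z, Q w z ≠ 0 := fun w z => (hQ0 w z).ne'
  have hOne : ∀ z a, Obs z a ≠ 0 := fun z a => (hO0 z a).ne'
  have hPO : ∏ i : Fin T, P (z i.castSucc) (z i.succ) * Obs (z i.succ) (x i.succ) ≠ 0 :=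
    Finset.prod_ne_zero_iff.2 fun _ _ => mul_ne_zero (hPne _ _) (hOne _ _)
  rw [Real.log_div (mul_ne_zero (mul_ne_zero (hπ0 _).ne' (hOne _ _)) hPO) (hqpos z).ne', hq,
    Real.log_mul (mul_ne_zero (hπ0 _).ne' (hOne _ _)) hPO,
    Real.log_mul (hπ0 _).ne' (hOne _ _),
    Real.log_mul (hr0 _).ne' (Finset.prod_ne_zero_iff.2 fun _ _ => hQne _ _),
    Real.log_prod fun _ _ => mul_ne_zero (hPne _ _) (hOne _ _),
    Real.log_prod fun _ _ => hQne _ _, Real.log_div (hr0 _).ne' (hπ0 _).ne', Fin.sum_univ_succ]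
  simp only [Real.log_mul (hPne _ _) (hOne _ _), Real.log_div (hQne _ _) (hPne _ _),
    Finset.sum_add_distrib, Finset.sum_sub_distrib]
  ring
end

section
/- Let X, Z, K be finite types and T a positive natural number. Fix an observed sequence x : Fin (T+1) → X. Let ρ : K → ℝ be a strictly positive probability mass function (the prior on the transformation type k), and for each k : K let π : Z → ℝ, P_k : Z → Z → ℝ, Obs : Z → X → ℝ, r : Z → ℝ, Q_k : Z → Z → ℝ be as follows: π and r are strictly positive probability mass functions, P_k, Q_k, Obs are strictly positive row-stochastic kernels. Let s : K → ℝ be a strictly positive probability mass function (the posterior over k given x). Define for each k the evidence L_k = ∑_{z : Fin (T+1) → Z} π (z 0) * Obs (z 0) (x 0) * ∏_{t=1}^{T} P_k (z (t−1)) (z t) * Obs (z t) (x t), and the posterior path weight q_k(z) = r (z 0) * ∏_{t=1}^{T} Q_k (z (t−1)) (z t). Then Real.log (∑_k ρ k * L_k) ≥ ∑_k s k * ( ∑_z q_k(z) * ∑_{t=0}^{T} Real.log (Obs (z t) (x t)) − KL(r‖π) − ∑_{t=1}^{T} ∑_z q_k(z) * KL(Q_k (z (t−1)) ‖ P_k (z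 (t−1))) ) − KL(s‖ρ). -/
open scoped Classical

theorem KL_of_pos {Z : Type*} [Fintype Z] {a : Z → ℝ} (ha : ∀ z, 0 < a z) (b : Z → ℝ) :
    KL a b = ∑ z, a z * Real.log (a z / b z) := by
  rw [KL, Finset.filter_true_of_mem fun z _ => ha z]

/-- Gibbs' variational inequality on a finite type. -/
theorem sum_mul_log_div_le_log_sum_s6 {ι : Type*} [Fintype ι] {a b : ι → ℝ}
    (ha : ∀ i, 0 < a i) (ha1 : ∑ i, a i = 1) (hb : ∀ i, 0 < b i) :
    ∑ i, a i * Real.log (b i / a i) ≤ Real.log (∑ i, b i) := by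
  have h := strictConcaveOn_log_Ioi.concaveOn.le_map_sum (t := Finset.univ) (w := a)
    (p := fun i => b i / a i) (fun i _ => (ha i).le) ha1 fun i _ => div_pos (hb i) (ha i)
  simpa only [smul_eq_mul, mul_div_cancel₀ _ (ha _).ne'] using h

/-- The weight of a path of a Markov chain with initial weights `r` and transition kernel `Q`. -/
def pathWeight {Z : Type*} (r : Z → ℝ) (Q : Z → Z → ℝ) {n : ℕ} (z : Fin (n + 1) → Z) : ℝ :=
  r (z 0) * ∏ i : Fin n, Q (z i.castSucc) (z i.succ)

theorem pathWeight_pos {Z : Type*} {r : Z → ℝ} {Q : Z → Z → ℝ} (hr : ∀ z, 0 < r z)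
    (hQ : ∀ w z, 0 < Q w z) {n : ℕ} (z : Fin (n + 1) → Z) : 0 < pathWeight r Q z :=
  mul_pos (hr _) (Finset.prod_pos fun _ _ => hQ _ _)

theorem pathWeight_snoc {Z : Type*} (r : Z → ℝ) (Q : Z → Z → ℝ) {n : ℕ}
    (y : Fin (n + 1) → Z) (w : Z) :
    pathWeight r Q (Fin.snoc y w : Fin (n + 2) → Z)
      = pathWeight r Q y * Q (y (Fin.last n)) w := by
  have h0 : (Fin.snoc y w : Fin (n + 2) → Z) 0 = y 0 :=
    Fin.snoc_castSucc (α := fun _ => Z) w y 0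
  simp only [pathWeight, Fin.prod_univ_castSucc, h0, Fin.succ_last, Fin.succ_castSucc,
    Fin.snoc_castSucc, Fin.snoc_last, mul_assoc]

theorem sum_pathWeight_succ {Z : Type*} [Fintype Z] (r : Z → ℝ) (Q : Z → Z → ℝ) {n : ℕ}
    (G : (Fin (n + 2) → Z) → ℝ) :
    ∑ z, pathWeight r Q z * G z
      = ∑ y : Fin (n + 1) → Z, pathWeight r Q y *
          ∑ w, Q (y (Fin.last n)) w * G (Fin.snoc y w : Fin (n + 2) → Z) := by
  rw [← (Fin.snocEquiv fun _ : Fin (n + 2) => Z).sum_comp, Fintype.sum_prod_type_right]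
  refine Finset.sum_congr rfl fun y _ => ?_
  rw [Finset.mul_sum]
  refine Finset.sum_congr rfl fun w _ => ?_
  rw [← mul_assoc, ← pathWeight_snoc]
  rfl

theorem sum_pathWeight_mul_zero {Z : Type*} [Fintype Z] (r : Z → ℝ) {Q : Z → Z → ℝ}
    (hQ : ∀ w, ∑ z, Q w z = 1) (f : Z → ℝ) (n : ℕ) :
    ∑ z : Fin (n + 1) → Z, pathWeight r Q z * f (z 0) = ∑ w, r w * f w := by
  induction n with
  | zero =>
    rw [← (Equiv.funUnique (Fin 1) Z).sum_comp]
    simp [pathWeight]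
  | succ n ih =>
    rw [sum_pathWeight_succ, ← ih]
    refine Finset.sum_congr rfl fun y _ => ?_
    have h0 (w : Z) : (Fin.snoc y w : Fin (n + 2) → Z) 0 = y 0 :=
      Fin.snoc_castSucc (α := fun _ => Z) w y 0
    simp only [h0, ← Finset.sum_mul, hQ, one_mul]

theorem sum_pathWeight {Z : Type*} [Fintype Z] {r : Z → ℝ} {Q : Z → Z → ℝ}
    (hr : ∑ z, r z = 1) (hQ : ∀ w, ∑ z, Q w z = 1) (n : ℕ) :
    ∑ z : Fin (n + 1) → Z, pathWeight r Q z = 1 := by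
  simpa [hr] using sum_pathWeight_mul_zero r hQ (fun _ => 1) n

/-- Conditioning a transition of a Markov chain on its starting point. -/
theorem sum_pathWeight_mul_step {Z : Type*} [Fintype Z] (r : Z → ℝ) {Q : Z → Z → ℝ}
    (hQ : ∀ w, ∑ z, Q w z = 1) (f : Z → Z → ℝ) {n : ℕ} (i : Fin n) :
    ∑ z, pathWeight r Q z * f (z i.castSucc) (z i.succ)
      = ∑ z : Fin (n + 1) → Z, pathWeight r Q z *
          ∑ w, Q (z i.castSucc) w * f (z i.castSucc) w := by
  induction n with
  | zero => exact i.elim0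
  | succ n ih =>
    rw [sum_pathWeight_succ, sum_pathWeight_succ]
    cases i using Fin.lastCases with
    | last =>
      simp only [Fin.succ_last, Fin.snoc_castSucc, Fin.snoc_last, ← Finset.sum_mul, hQ, one_mul]
    | cast j =>
      simp only [Fin.succ_castSucc, Fin.snoc_castSucc, ← Finset.sum_mul, hQ, one_mul]
      exact ih j

/-- The evidence lower bound for a hidden Markov model, with `o t z` the likelihood of the
observation at time `t` in state `z`. -/
theorem sequence_elbo_s6 {Z : Type*} [Fintype Z] {n : ℕ} {π r : Z → ℝ} {P Q : Z → Z → ℝ}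
    {o : Fin (n + 1) → Z → ℝ} (hπ : ∀ z, 0 < π z) (hP : ∀ w z, 0 < P w z)
    (ho : ∀ t z, 0 < o t z) (hr : ∀ z, 0 < r z) (hr1 : ∑ z, r z = 1)
    (hQ : ∀ w z, 0 < Q w z) (hQ1 : ∀ w, ∑ z, Q w z = 1) :
    (∑ z : Fin (n + 1) → Z, pathWeight r Q z * ∑ t, Real.log (o t (z t))) - KL r π
        - ∑ i : Fin n, ∑ z : Fin (n + 1) → Z,
            pathWeight r Q z * KL (Q (z i.castSucc)) (P (z i.castSucc))
      ≤ Real.log (∑ z : Fin (n + 1) → Z, π (z 0) * o 0 (z 0) *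
          ∏ i : Fin n, P (z i.castSucc) (z i.succ) * o i.succ (z i.succ)) := by
  refine le_trans (le_of_eq ?_) (sum_mul_log_div_le_log_sum_s6
    (fun z => pathWeight_pos hr hQ z) (sum_pathWeight hr1 hQ1 n)
    fun z => mul_pos (mul_pos (hπ _) (ho _ _))
      (Finset.prod_pos fun _ _ => mul_pos (hP _ _) (ho _ _)))
  have hlog (z : Fin (n + 1) → Z) :
      Real.log (π (z 0) * o 0 (z 0) *
          (∏ i : Fin n, P (z i.castSucc) (z i.succ) * o i.succ (z i.succ)) / pathWeight r Q z)
        = (∑ t, Real.log (o t (z t))) - Real.log (r (z 0) / π (z 0))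
          - ∑ i : Fin n, Real.log (Q (z i.castSucc) (z i.succ) / P (z i.castSucc) (z i.succ)) := by
    have hPo : ∏ i : Fin n, P (z i.castSucc) (z i.succ) * o i.succ (z i.succ) ≠ 0 :=
      Finset.prod_ne_zero_iff.2 fun i _ => (mul_pos (hP _ _) (ho _ _)).ne'
    have hQp : ∏ i : Fin n, Q (z i.castSucc) (z i.succ) ≠ 0 :=
      Finset.prod_ne_zero_iff.2 fun i _ => (hQ _ _).ne'
    rw [Real.log_div (mul_ne_zero (mul_pos (hπ _) (ho _ _)).ne' hPo)
        (pathWeight_pos hr hQ z).ne', pathWeight, Real.log_mul (hr _).ne' hQp,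
      Real.log_mul (mul_pos (hπ _) (ho _ _)).ne' hPo, Real.log_mul (hπ _).ne' (ho _ _).ne',
      Real.log_prod fun i _ => (mul_pos (hP _ _) (ho _ _)).ne',
      Real.log_prod fun i _ => (hQ _ _).ne', Real.log_div (hr _).ne' (hπ _).ne',
      Fin.sum_univ_succ]
    simp only [Real.log_mul (hP _ _).ne' (ho _ _).ne', Real.log_div (hQ _ _).ne' (hP _ _).ne',
      Finset.sum_add_distrib, Finset.sum_sub_distrib]
    ring
  simp only [hlog, mul_sub, Finset.sum_sub_distrib, KL_of_pos hr, KL_of_pos (hQ _)]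
  congr 1
  · rw [sum_pathWeight_mul_zero r hQ1 fun w => Real.log (r w / π w)]
  · simp only [Finset.mul_sum (s := (Finset.univ : Finset (Fin n)))]
    rw [Finset.sum_comm (s := (Finset.univ : Finset (Fin (n + 1) → Z)))]
    exact Finset.sum_congr rfl fun i _ =>
      (sum_pathWeight_mul_step r hQ1 (fun w z => Real.log (Q w z / P w z)) i).symm

/-- Weakly-supervised ELBO for the mixture-of-transformations sequence model: the
log-evidence of the mixture is bounded below by the expected per-component ELBO
under the posterior `s` over the transformation type, minus `KL(s‖ρ)`. -/
theorem mixture_sequence_elbo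
    (X Z K : Type*) [Fintype X] [Fintype Z] [Fintype K] (T : ℕ) (hT : 0 < T)
    (x : Fin (T + 1) → X)
    (ρ : K → ℝ) (hρ0 : ∀ k, 0 < ρ k) (hρ1 : ∑ k : K, ρ k = 1)
    (π : Z → ℝ) (hπ0 : ∀ z, 0 < π z) (hπ1 : ∑ z : Z, π z = 1)
    (P : K → Z → Z → ℝ) (hP0 : ∀ k w z, 0 < P k w z) (hP1 : ∀ k w, ∑ z : Z, P k w z = 1)
    (Obs : Z → X → ℝ) (hO0 : ∀ z a, 0 < Obs z a) (hO1 : ∀ z, ∑ a : X, Obs z a = 1)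
    (r : Z → ℝ) (hr0 : ∀ z, 0 < r z) (hr1 : ∑ z : Z, r z = 1)
    (Q : K → Z → Z → ℝ) (hQ0 : ∀ k w z, 0 < Q k w z) (hQ1 : ∀ k w, ∑ z : Z, Q k w z = 1)
    (s : K → ℝ) (hs0 : ∀ k, 0 < s k) (hs1 : ∑ k : K, s k = 1)
    (L : K → ℝ)
    (hL : ∀ k, L k = ∑ z : Fin (T + 1) → Z,
      π (z 0) * Obs (z 0) (x 0) *
        ∏ i : Fin T, P k (z i.castSucc) (z i.succ) * Obs (z i.succ) (x i.succ))
    (q : K → (Fin (T + 1) → Z) → ℝ)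
    (hq : ∀ k z, q k z = r (z 0) * ∏ i : Fin T, Q k (z i.castSucc) (z i.succ)) :
    Real.log (∑ k : K, ρ k * L k)
      ≥ (∑ k : K, s k *
          ((∑ z : Fin (T + 1) → Z,
              q k z * ∑ t : Fin (T + 1), Real.log (Obs (z t) (x t)))
            - KL r π
            - ∑ i : Fin T, ∑ z : Fin (T + 1) → Z,
                q k z * KL (Q k (z i.castSucc)) (P k (z i.castSucc))))
        - KL s ρ := by
  obtain ⟨z₀⟩ : Nonempty Z := by
    by_contra h
    rw [not_nonempty_iff] at h
    simp at hr1
  have hLpos (k : K) : 0 < L k := by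
    rw [hL]
    exact Finset.sum_pos (fun z _ => mul_pos (mul_pos (hπ0 _) (hO0 _ _))
      (Finset.prod_pos fun _ _ => mul_pos (hP0 _ _ _) (hO0 _ _))) ⟨fun _ => z₀, Finset.mem_univ _⟩
  refine le_trans ?_
    (sum_mul_log_div_le_log_sum_s6 hs0 hs1 fun k => mul_pos (hρ0 k) (hLpos k))
  rw [KL_of_pos hs0, ← Finset.sum_sub_distrib]
  refine Finset.sum_le_sum fun k _ => ?_
  rw [Real.log_div (mul_pos (hρ0 k) (hLpos k)).ne' (hs0 k).ne',
    Real.log_mul (hρ0 k).ne' (hLpos k).ne', Real.log_div (hs0 k).ne' (hρ0 k).ne', ← mul_sub]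
  have helbo := sequence_elbo_s6 (o := fun t z => Obs z (x t)) hπ0 (hP0 k)
    (fun _ _ => hO0 _ _) hr0 hr1 (hQ0 k) (hQ1 k)
  rw [← hL] at helbo
  have hqk : q k = pathWeight r (Q k) := funext (hq k)
  rw [hqk]
  exact mul_le_mul_of_nonneg_left (by linarith) (hs0 k).le
end

section
/- Let n be a positive natural number and x : Fin n → ℝ, and suppose i₀ : Fin n is a strict maximizer of x, i.e. x j < x i₀ for all j ≠ i₀. For τ > 0 define the tempered softmax S_τ : Fin n → ℝ by S_τ j = Real.exp (x j / τ) / ∑_i Real.exp (x i / τ). Then as τ → 0 from the right, S_τ j tends to 1 if j = i₀ and to 0 otherwise; that is, the tempered softmax converges to the one-hot indicator of the argmax. -/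
open Filter Topology in
/-- For `c < 0`, `exp (c / τ)` vanishes as `τ → 0⁺`. -/
theorem tendsto_exp_div_nhdsGT_zero {c : ℝ} (hc : c < 0) :
    Tendsto (fun τ : ℝ => Real.exp (c / τ)) (𝓝[>] 0) (𝓝 0) := by
  simp only [div_eq_mul_inv]
  exact Real.tendsto_exp_atBot.comp (tendsto_inv_nhdsGT_zero.const_mul_atTop_of_neg hc)

/-- The tempered softmax converges to the one-hot indicator of the (strict) argmax
as the temperature tends to `0⁺`. -/
theorem tempered_softmax_tendsto_one_hot
    (n : ℕ) (hn : 0 < n) (x : Fin n → ℝ) (i₀ : Fin n)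
    (hmax : ∀ j, j ≠ i₀ → x j < x i₀) :
    ∀ j : Fin n,
      Filter.Tendsto
        (fun τ : ℝ => Real.exp (x j / τ) / ∑ i : Fin n, Real.exp (x i / τ))
        (nhdsWithin 0 (Set.Ioi 0))
        (nhds (if j = i₀ then (1 : ℝ) else 0)) := by
  intro j
  have key (i : Fin n) : Filter.Tendsto (fun τ : ℝ => Real.exp ((x i - x i₀) / τ))
      (nhdsWithin 0 (Set.Ioi 0)) (nhds (if i = i₀ then (1 : ℝ) else 0)) := by
    split_ifs with h
    · simp [h]
    · exact tendsto_exp_div_nhdsGT_zero (sub_neg.2 (hmax i h))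
  have hsum := tendsto_finsetSum Finset.univ fun i _ => key i
  have hlim := (key j).div hsum (by simp)
  simp only [Finset.sum_ite_eq', Finset.mem_univ, if_true, div_one] at hlim
  refine hlim.congr fun τ => ?_
  simp only [Pi.div_apply, sub_div, Real.exp_sub, ← Finset.sum_div]
  exact div_div_div_cancel_right₀ (Real.exp_ne_zero _) _ _
end

section
/- Let n be a positive natural number, x : Fin n → ℝ, and let μ be the product over i : Fin n of n independent copies of the standard Gumbel measure γ on ℝ, viewed as a measure on Fin n → ℝ. Then for every k : Fin n, μ {g : Fin n → ℝ | ∀ j ≠ k, x k + g k > x j + g j} = Real.exp (x k) / ∑_{j} Real.exp (x j). (The Gumbel-max trick: adding independent standard Gumbel noise to logits and taking the argmax samples the category k with probability softmax(x)_k.) -/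
open MeasureTheory Set

/-- The standard Gumbel measure on `ℝ`. -/
noncomputable def gumbelMeasure : Measure ℝ :=
  volume.withDensity fun g : ℝ => ENNReal.ofReal (Real.exp (-(g + Real.exp (-g))))

instance sigmaFinite_gumbelMeasure : SigmaFinite gumbelMeasure :=
  SigmaFinite.withDensity_of_ne_top (by simp)

theorem hasDerivAt_exp_neg_mul_exp_neg_div {A : ℝ} (hA : 0 < A) (g : ℝ) :
    HasDerivAt (fun g : ℝ => Real.exp (-(A * Real.exp (-g))) / A)
      (Real.exp (-(g + A * Real.exp (-g)))) g := by
  have h := ((((hasDerivAt_neg g).exp.const_mul A).neg).exp).div_const A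
  refine h.congr_deriv ?_
  rw [neg_add, Real.exp_add, Pi.neg_apply]
  field_simp

theorem strictMono_exp_neg_mul_exp_neg_div {A : ℝ} (hA : 0 < A) :
    StrictMono (fun g : ℝ => Real.exp (-(A * Real.exp (-g))) / A) := by
  intro a b hab
  dsimp only
  gcongr

theorem exists_exp_neg_mul_exp_neg_div_eq {A y : ℝ} (hA : 0 < A) (h0 : 0 < y)
    (h1 : y < 1 / A) : ∃ g : ℝ, Real.exp (-(A * Real.exp (-g))) / A = y := by
  have hlt : y * A < 1 := (lt_div_iff₀ hA).1 h1
  have hlog : 0 < -Real.log (y * A) / A :=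
    div_pos (neg_pos.2 (Real.log_neg (by positivity) hlt)) hA
  refine ⟨-Real.log (-Real.log (y * A) / A), ?_⟩
  rw [neg_neg, Real.exp_log hlog, mul_div_cancel₀ _ hA.ne', neg_neg,
    Real.exp_log (by positivity), mul_div_cancel_right₀ _ hA.ne']

theorem exp_neg_mul_exp_neg_div_lt {A : ℝ} (hA : 0 < A) (g : ℝ) :
    Real.exp (-(A * Real.exp (-g))) / A < 1 / A := by
  gcongr
  rw [Real.exp_lt_one_iff, neg_lt_zero]
  positivity

theorem lintegral_exp_neg_add_mul_exp_neg {A : ℝ} (hA : 0 < A) :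
    ∫⁻ g : ℝ, ENNReal.ofReal (Real.exp (-(g + A * Real.exp (-g)))) = ENNReal.ofReal (1 / A) := by
  rw [← setLIntegral_univ, lintegral_deriv_eq_volume_image_of_monotoneOn MeasurableSet.univ
    (fun g _ => (hasDerivAt_exp_neg_mul_exp_neg_div hA g).hasDerivWithinAt)
    ((strictMono_exp_neg_mul_exp_neg_div hA).monotone.monotoneOn _)]
  have : (fun g : ℝ => Real.exp (-(A * Real.exp (-g))) / A) '' univ = Ioo 0 (1 / A) := by
    ext y
    constructor
    · rintro ⟨g, -, rfl⟩
      exact ⟨by positivity, exp_neg_mul_exp_neg_div_lt hA g⟩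
    · rintro ⟨h0, h1⟩
      obtain ⟨g, hg⟩ := exists_exp_neg_mul_exp_neg_div_eq hA h0 h1
      exact ⟨g, mem_univ _, hg⟩
  rw [this, Real.volume_Ioo, sub_zero]

theorem gumbelMeasure_Iio (t : ℝ) :
    gumbelMeasure (Iio t) = ENNReal.ofReal (Real.exp (-Real.exp (-t))) := by
  have hd := fun g => hasDerivAt_exp_neg_mul_exp_neg_div one_pos g
  have hm := strictMono_exp_neg_mul_exp_neg_div one_pos
  have hs := fun y => exists_exp_neg_mul_exp_neg_div_eq (y := y) one_pos
  have hl := exp_neg_mul_exp_neg_div_lt one_pos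
  simp only [one_mul, div_one] at hd hm hs hl
  rw [gumbelMeasure, withDensity_apply _ measurableSet_Iio,
    lintegral_deriv_eq_volume_image_of_monotoneOn measurableSet_Iio
      (fun g _ => (hd g).hasDerivWithinAt) (hm.monotone.monotoneOn _)]
  have : (fun g : ℝ => Real.exp (-Real.exp (-g))) '' Iio t
      = Ioo 0 (Real.exp (-Real.exp (-t))) := by
    ext y
    constructor
    · rintro ⟨g, hg, rfl⟩
      exact ⟨by positivity, hm hg⟩
    · rintro ⟨h0, h1⟩
      obtain ⟨g, rfl⟩ := hs y h0 (h1.trans (hl t))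
      exact ⟨g, hm.lt_iff_lt.1 h1, rfl⟩
  rw [this, Real.volume_Ioo, sub_zero]

theorem pi_gumbelMeasure_forall_lt {m : ℕ} (x : Fin m → ℝ) (c : ℝ) :
    Measure.pi (fun _ : Fin m => gumbelMeasure) {h | ∀ i, x i + h i < c}
      = ENNReal.ofReal (Real.exp (-((∑ i, Real.exp (x i)) * Real.exp (-c)))) := by
  have : {h : Fin m → ℝ | ∀ i, x i + h i < c} = univ.pi fun i => Iio (c - x i) := by
    ext h
    simp [lt_sub_iff_add_lt']
  rw [this, Measure.pi_pi]
  simp only [gumbelMeasure_Iio]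
  rw [← ENNReal.ofReal_prod_of_nonneg fun _ _ => (Real.exp_pos _).le, ← Real.exp_sum,
    Finset.sum_neg_distrib, Finset.sum_mul]
  simp only [← Real.exp_add, neg_sub, ← sub_eq_add_neg]

/-- The Gumbel-max trick: adding i.i.d. standard Gumbel noise to logits and taking
the argmax samples category `k` with probability `softmax(x)_k`. -/
theorem gumbel_max_trick
    (n : ℕ) (hn : 0 < n) (x : Fin n → ℝ) (k : Fin n) :
    MeasureTheory.Measure.pi
        (fun _ : Fin n => MeasureTheory.volume.withDensity fun g : ℝ =>
          ENNReal.ofReal (Real.exp (-(g + Real.exp (-g)))))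
        {g : Fin n → ℝ | ∀ j, j ≠ k → x j + g j < x k + g k}
      = ENNReal.ofReal (Real.exp (x k) / ∑ j : Fin n, Real.exp (x j)) := by
  obtain ⟨m, rfl⟩ := Nat.exists_eq_succ_of_ne_zero hn.ne'
  change Measure.pi (fun _ => gumbelMeasure) _ = _
  set S : Set (ℝ × (Fin m → ℝ)) :=
    {p | ∀ i, x (k.succAbove i) + p.2 i < x k + p.1} with hS
  have hSm : MeasurableSet S := by
    rw [hS, ofPred_forall]
    exact MeasurableSet.iInter fun i => measurableSet_lt (by fun_prop) (by fun_prop)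
  have hpre : {g : Fin (m + 1) → ℝ | ∀ j, j ≠ k → x j + g j < x k + g k}
      = MeasurableEquiv.piFinSuccAbove (fun _ => ℝ) k ⁻¹' S := by
    ext g
    simp [hS, k.forall_iff_succAbove, Fin.removeNth]
  rw [hpre, (measurePreserving_piFinSuccAbove (fun _ => gumbelMeasure) k).measure_preimage
    hSm.nullMeasurableSet, Measure.prod_apply hSm]
  have hfib (a : ℝ) : Measure.pi (fun _ : Fin m => gumbelMeasure) (Prod.mk a ⁻¹' S) =
      ENNReal.ofReal (Real.exp (-((∑ i, Real.exp (x (k.succAbove i))) * Real.exp (-(x k + a))))) :=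
    pi_gumbelMeasure_forall_lt (fun i => x (k.succAbove i)) (x k + a)
  simp only [hfib]
  rw [gumbelMeasure, lintegral_withDensity_eq_lintegral_mul _ (by fun_prop) (by fun_prop)]
  have hsum : 0 < ∑ j, Real.exp (x j) :=
    Finset.sum_pos (fun _ _ => Real.exp_pos _) ⟨k, Finset.mem_univ k⟩
  have key := lintegral_exp_neg_add_mul_exp_neg (div_pos hsum (Real.exp_pos (x k)))
  rw [one_div_div] at key
  rw [← key]
  refine lintegral_congr fun a => ?_
  rw [Pi.mul_apply, ← ENNReal.ofReal_mul (Real.exp_pos _).le, ← Real.exp_add,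
    Fin.sum_univ_succAbove _ k, neg_add (x k) a, Real.exp_add (-x k), Real.exp_neg (x k)]
  congr 2
  field_simp
  ring
end
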